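/- Let F = (u₀, u₁, …, u_n) be a system of conjugate harmonic functions on the upper half-space ℝⁿ × (0,∞) (i.e., the gradient of a harmonic function, satisfying the generalized Cauchy–Riemann equations). Then |F|^ε is subharmonic for every ε ≥ (n−1)/n. -/

import Mathlib

open MeasureTheory Real Filter
noncomputable section

/-- Subharmonic on a set: continuous and satisfies the sub-mean value property on
closed balls contained in the set. -/
def SubharmonicOn' {m : ℕ} (f : EuclideanSpace ℝ (Fin m) → ℝ)
    (s : Set (EuclideanSpace ℝ (Fin m))) : Prop :=
  ContinuousOn f s ∧ ∀ (c : EuclideanSpace ℝ (Fin m)) (r : ℝ), 0 < r →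
    Metric.closedBall c r ⊆ s → f c ≤ ⨍ y in Metric.closedBall c r, f y

/-- The open upper half-space `ℝⁿ × (0,∞)`, seen inside `ℝ^{n+1}`. -/
def upperHalf (n : ℕ) : Set (EuclideanSpace ℝ (Fin (n + 1))) :=
  {x | 0 < x (Fin.last n)}

/-- The integral of a directional derivative of a compactly supported `C¹` function vanishes. -/
theorem integral_fderiv_apply_eq_zero {m : ℕ} {X : EuclideanSpace ℝ (Fin m) → ℝ}
    (hX : ContDiff ℝ 1 X) (hc : HasCompactSupport X) (e : EuclideanSpace ℝ (Fin m)) :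
    ∫ y, fderiv ℝ X y e = 0 := by
  have hd : Integrable (fun y => fderiv ℝ X y e) :=
    ((hX.continuous_fderiv one_ne_zero).clm_apply continuous_const).integrable_of_hasCompactSupport
      ((hc.fderiv ℝ).comp_left (g := fun L : EuclideanSpace ℝ (Fin m) →L[ℝ] ℝ => L e) rfl)
  have h := integral_mul_fderiv_eq_neg_fderiv_mul_of_integrable (μ := volume) (f := X)
    (g := fun _ : EuclideanSpace ℝ (Fin m) => (1 : ℝ)) (v := e)
    (by simpa using hd) (by simp) (by simpa using hX.continuous.integrable_of_hasCompactSupport hc)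
    (fun x _ => (hX.differentiable one_ne_zero) x) (fun x _ => by fun_prop)
  simpa using h.symm

/-- The value at a point of the Laplacian of `v`, as the trace of the second derivative. -/
def traceHessian {m : ℕ} (v : EuclideanSpace ℝ (Fin m) → ℝ) (x : EuclideanSpace ℝ (Fin m)) : ℝ :=
  ∑ i, fderiv ℝ (fderiv ℝ v) x (EuclideanSpace.single i 1) (EuclideanSpace.single i 1)

/-- A continuous nonnegative function of one variable vanishing on `[1, ∞)` is minus the derivative
of a `C¹` function with the same properties. -/
theorem exists_antiderivative_of_cutoff {K : ℝ → ℝ} (hK : Continuous K) (h0 : ∀ s, 0 ≤ K s)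
    (h1 : ∀ s, 1 ≤ s → K s = 0) :
    ∃ H : ℝ → ℝ, (∀ s, HasDerivAt H (-K s) s) ∧ (∀ s, 0 ≤ H s) ∧ ∀ s, 1 ≤ s → H s = 0 := by
  have hz : ∀ s, 1 ≤ s → ∫ t in s..1, K t = 0 := by
    intro s hs
    rw [intervalIntegral.integral_congr (g := fun _ => (0 : ℝ)), intervalIntegral.integral_zero]
    intro t ht
    rw [Set.uIcc_of_ge hs] at ht
    exact h1 t ht.1
  refine ⟨fun s => ∫ t in s..1, K t, fun s => ?_, fun s => ?_, hz⟩
  · exact intervalIntegral.integral_hasDerivAt_left (hK.intervalIntegrable _ _)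
      (hK.stronglyMeasurableAtFilter _ _) hK.continuousAt
  · rcases le_total s 1 with hs | hs
    · exact intervalIntegral.integral_nonneg hs fun t _ => h0 t
    · exact (hz s hs).ge

/-- A function of the squared norm vanishing on `[1, ∞)` has compact support. -/
theorem hasCompactSupport_comp_norm_sq {m : ℕ} {H : ℝ → ℝ} (h1 : ∀ s, 1 ≤ s → H s = 0) :
    HasCompactSupport fun y : EuclideanSpace ℝ (Fin m) => H (‖y‖ ^ 2) := by
  refine HasCompactSupport.intro (isCompact_closedBall 0 1) fun y hy => h1 _ ?_
  simp only [Metric.mem_closedBall, dist_zero_right, not_le] at hy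
  nlinarith

/-- Product rule for a radial weight times a directional derivative of a dilated function. -/
theorem fderiv_radial_mul_fderiv_dilation {m : ℕ} {v : EuclideanSpace ℝ (Fin m) → ℝ}
    (hv : Differentiable ℝ (fderiv ℝ v)) {H K : ℝ → ℝ} (hH : ∀ s, HasDerivAt H (-K s) s)
    (c : EuclideanSpace ℝ (Fin m)) (ρ : ℝ) (i : Fin m) (y : EuclideanSpace ℝ (Fin m)) :
    fderiv ℝ (fun y => H (‖y‖ ^ 2) * fderiv ℝ v (c + ρ • y) (EuclideanSpace.single i 1)) y
        (EuclideanSpace.single i 1) =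
      -2 * (K (‖y‖ ^ 2) * (y i * fderiv ℝ v (c + ρ • y) (EuclideanSpace.single i 1))) +
        ρ * (H (‖y‖ ^ 2) * fderiv ℝ (fderiv ℝ v) (c + ρ • y) (EuclideanSpace.single i 1)
          (EuclideanSpace.single i 1)) := by
  have d1 : HasFDerivAt (fun y : EuclideanSpace ℝ (Fin m) => H (‖y‖ ^ 2))
      ((-K (‖y‖ ^ 2)) • (2 • innerSL ℝ y)) y :=
    (hH (‖y‖ ^ 2)).comp_hasFDerivAt y (hasStrictFDerivAt_norm_sq y).hasFDerivAt
  have d0 : HasFDerivAt (fun y : EuclideanSpace ℝ (Fin m) => c + ρ • y)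
      (ρ • ContinuousLinearMap.id ℝ (EuclideanSpace ℝ (Fin m))) y :=
    ((hasFDerivAt_id y).const_smul ρ).const_add c
  have d2 : HasFDerivAt (fun y => fderiv ℝ v (c + ρ • y)) _ y :=
    (hv (c + ρ • y)).hasFDerivAt.comp y d0
  have d3 := d2.clm_apply (hasFDerivAt_const (EuclideanSpace.single i (1 : ℝ)) y)
  rw [(d1.fun_mul d3).fderiv]
  simp [EuclideanSpace.inner_single_right]
  ring

/-- For a radial weight on the unit ball, the weighted radial derivative of a function with
nonnegative Laplacian has nonnegative integral. -/
theorem integral_cutoff_mul_radial_fderiv_nonneg {m : ℕ} {v : EuclideanSpace ℝ (Fin m) → ℝ}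
    (hv : ContDiff ℝ 2 v) {c : EuclideanSpace ℝ (Fin m)} {r : ℝ}
    (hlap : ∀ x ∈ Metric.closedBall c r, 0 ≤ traceHessian v x)
    {K : ℝ → ℝ} (hK : Continuous K) (h0 : ∀ s, 0 ≤ K s) (h1 : ∀ s, 1 ≤ s → K s = 0)
    {ρ : ℝ} (hρ : 0 ≤ ρ) (hρr : ρ ≤ r) :
    0 ≤ ∫ y, K (‖y‖ ^ 2) * fderiv ℝ v (c + ρ • y) y := by
  obtain ⟨H, hH, H0, H1⟩ := exists_antiderivative_of_cutoff hK h0 h1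
  have hHc : ContDiff ℝ 1 H := by
    refine contDiff_one_iff_deriv.2 ⟨fun s => (hH s).differentiableAt, ?_⟩
    rw [show deriv H = fun s => -K s from funext fun s => (hH s).deriv]
    exact hK.neg
  have hv1 : ContDiff ℝ 1 (fderiv ℝ v) := hv.fderiv_right (by norm_num)
  let e : Fin m → EuclideanSpace ℝ (Fin m) := fun i => EuclideanSpace.single i 1
  let X : Fin m → EuclideanSpace ℝ (Fin m) → ℝ :=
    fun i y => H (‖y‖ ^ 2) * fderiv ℝ v (c + ρ • y) (e i)
  have hX : ∀ i, ContDiff ℝ 1 (X i) := by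
    intro i
    have hl : ContDiff ℝ 1 fun y : EuclideanSpace ℝ (Fin m) => c + ρ • y := by fun_prop
    have h2 : ContDiff ℝ 1 fun y => fderiv ℝ v (c + ρ • y) := hv1.comp hl
    exact (hHc.comp (contDiff_id.norm_sq ℝ)).mul (h2.clm_apply contDiff_const)
  have hXc : ∀ i, HasCompactSupport (X i) := fun i =>
    (hasCompactSupport_comp_norm_sq H1).mul_right
  have hXd : ∀ i y, fderiv ℝ (X i) y (e i) =
      -2 * (K (‖y‖ ^ 2) * (y i * fderiv ℝ v (c + ρ • y) (e i))) +
        ρ * (H (‖y‖ ^ 2) * fderiv ℝ (fderiv ℝ v) (c + ρ • y) (e i) (e i)) :=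
    fun i y => fderiv_radial_mul_fderiv_dilation (hv1.differentiable one_ne_zero) hH c ρ i y
  have hsum : ∀ y, ∑ i, fderiv ℝ (X i) y (e i) =
      -2 * (K (‖y‖ ^ 2) * fderiv ℝ v (c + ρ • y) y) +
        ρ * (H (‖y‖ ^ 2) * traceHessian v (c + ρ • y)) := by
    intro y
    have hy : fderiv ℝ v (c + ρ • y) y = ∑ i, y i * fderiv ℝ v (c + ρ • y) (e i) := by
      have h := congrArg (fderiv ℝ v (c + ρ • y)) ((EuclideanSpace.basisFun (Fin m) ℝ).sum_repr y)
      simpa [e, map_sum] using h.symm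
    simp only [hXd, Finset.sum_add_distrib, ← Finset.mul_sum, hy, traceHessian, e]
  have h_integral : ∫ y, ∑ i, fderiv ℝ (X i) y (e i) = 0 := by
    rw [integral_finsetSum]
    · exact Finset.sum_eq_zero fun i _ => integral_fderiv_apply_eq_zero (hX i) (hXc i) (e i)
    · exact fun i _ => (((hX i).continuous_fderiv one_ne_zero).clm_apply
        continuous_const).integrable_of_hasCompactSupport
        (((hXc i).fderiv ℝ).comp_left (g := fun L : EuclideanSpace ℝ (Fin m) →L[ℝ] ℝ => L (e i)) rfl)
  have hKi : Integrable fun y => K (‖y‖ ^ 2) * fderiv ℝ v (c + ρ • y) y := by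
    refine Continuous.integrable_of_hasCompactSupport ?_
      (hasCompactSupport_comp_norm_sq h1).mul_right
    have := hv1.continuous
    fun_prop
  have hHi : Integrable fun y => H (‖y‖ ^ 2) * traceHessian v (c + ρ • y) := by
    refine Continuous.integrable_of_hasCompactSupport ?_
      (hasCompactSupport_comp_norm_sq H1).mul_right
    have := hHc.continuous
    have := hv1.continuous_fderiv one_ne_zero
    unfold traceHessian
    fun_prop
  simp only [hsum] at h_integral
  rw [integral_add (hKi.const_mul _) (hHi.const_mul _), integral_const_mul,
    integral_const_mul] at h_integral
  have hpos : 0 ≤ ∫ y, H (‖y‖ ^ 2) * traceHessian v (c + ρ • y) := by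
    refine integral_nonneg fun y => ?_
    rcases le_total ‖y‖ 1 with hy | hy
    · refine mul_nonneg (H0 _) (hlap _ ?_)
      simp only [Metric.mem_closedBall, dist_self_add_left, norm_smul, Real.norm_eq_abs,
        abs_of_nonneg hρ]
      nlinarith [norm_nonneg y]
    · simp [H1 (‖y‖ ^ 2) (by nlinarith)]
  nlinarith [mul_nonneg hρ hpos]

/-- Sub-mean value inequality for a radial weight supported in the unit ball. -/
theorem integral_cutoff_mul_le {m : ℕ} {v : EuclideanSpace ℝ (Fin m) → ℝ}
    (hv : ContDiff ℝ 2 v) {c : EuclideanSpace ℝ (Fin m)} {r : ℝ} (hr : 0 < r)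
    (hlap : ∀ x ∈ Metric.closedBall c r, 0 ≤ traceHessian v x)
    {K : ℝ → ℝ} (hK : Continuous K) (h0 : ∀ s, 0 ≤ K s) (h1 : ∀ s, 1 ≤ s → K s = 0) :
    ∫ y : EuclideanSpace ℝ (Fin m), K (‖y‖ ^ 2) * v c ≤ ∫ y, K (‖y‖ ^ 2) * v (c + r • y) := by
  have hv0 := hv.continuous
  have hv1 := hv.continuous_fderiv two_ne_zero
  obtain ⟨C, hC⟩ := ((isCompact_closedBall c (r + 1)).image_of_continuousOn
    hv1.norm.continuousOn).bddAbove
  have hC' : ∀ x ∈ Metric.closedBall c (r + 1), ‖fderiv ℝ v x‖ ≤ C := fun x hx =>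
    hC (Set.mem_image_of_mem _ hx)
  have hd : ∀ ρ ∈ Set.Icc 0 r, HasDerivAt (fun ρ : ℝ => ∫ y, K (‖y‖ ^ 2) * v (c + ρ • y))
      (∫ y, K (‖y‖ ^ 2) * fderiv ℝ v (c + ρ • y) y) ρ := by
    intro ρ hρ
    refine (hasDerivAt_integral_of_dominated_loc_of_deriv_le (bound := fun y => K (‖y‖ ^ 2) * C)
      (F := fun ρ y => K (‖y‖ ^ 2) * v (c + ρ • y))
      (F' := fun ρ y => K (‖y‖ ^ 2) * fderiv ℝ v (c + ρ • y) y)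
      (Metric.ball_mem_nhds ρ one_pos) (.of_forall fun ρ => ?_) ?_ ?_ (.of_forall ?_) ?_
      (.of_forall ?_)).2
    · exact Continuous.aestronglyMeasurable (by fun_prop)
    · exact Continuous.integrable_of_hasCompactSupport (by fun_prop)
        (hasCompactSupport_comp_norm_sq h1).mul_right
    · exact Continuous.aestronglyMeasurable (by fun_prop)
    · intro y t ht
      rcases le_total ‖y‖ 1 with hy | hy
      · rw [norm_mul, Real.norm_of_nonneg (h0 _)]
        refine mul_le_mul_of_nonneg_left ?_ (h0 _)
        have ht' : |t| ≤ r + 1 := by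
          rw [Metric.mem_ball, Real.dist_eq, abs_lt] at ht
          rw [abs_le]
          constructor <;> linarith [hρ.1, hρ.2, ht.1, ht.2]
        have hmem : c + t • y ∈ Metric.closedBall c (r + 1) := by
          simp only [Metric.mem_closedBall, dist_self_add_left, norm_smul, Real.norm_eq_abs]
          nlinarith [norm_nonneg y, abs_nonneg t]
        have := hC' _ hmem
        refine ((fderiv ℝ v (c + t • y)).le_opNorm y).trans ?_
        nlinarith [norm_nonneg (fderiv ℝ v (c + t • y))]
      · simp [h1 (‖y‖ ^ 2) (by nlinarith)]
    · exact Continuous.integrable_of_hasCompactSupport (by fun_prop)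
        (hasCompactSupport_comp_norm_sq h1).mul_right
    · intro y t _
      refine HasDerivAt.const_mul _ ?_
      have hl : HasDerivAt (fun t : ℝ => c + t • y) y t := by
        simpa using ((hasDerivAt_id t).smul_const y).const_add c
      exact ((hv.differentiable two_ne_zero) (c + t • y)).hasFDerivAt.comp_hasDerivAt t hl
  have hmono : MonotoneOn (fun ρ : ℝ => ∫ y, K (‖y‖ ^ 2) * v (c + ρ • y)) (Set.Icc 0 r) := by
    refine monotoneOn_of_deriv_nonneg (convex_Icc 0 r)
      (fun ρ hρ => (hd ρ hρ).continuousAt.continuousWithinAt)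
      (fun ρ hρ => (hd ρ (interior_subset hρ)).differentiableAt.differentiableWithinAt)
      fun ρ hρ => ?_
    have hρ' := interior_subset hρ
    rw [(hd ρ hρ').deriv]
    exact integral_cutoff_mul_radial_fderiv_nonneg hv hlap hK h0 h1 hρ'.1 hρ'.2
  simpa using hmono (Set.left_mem_Icc.2 hr.le) (Set.right_mem_Icc.2 hr.le) hr.le

/-- Change of variables from the unit ball to an arbitrary ball. -/
theorem setIntegral_closedBall_eq_setIntegral_unit_ball {m : ℕ}
    (v : EuclideanSpace ℝ (Fin m) → ℝ) (c : EuclideanSpace ℝ (Fin m)) {r : ℝ} (hr : 0 < r) :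
    ∫ x in Metric.closedBall c r, v x = r ^ m * ∫ y in Metric.ball 0 1, v (c + r • y) := by
  have hae : Metric.closedBall c r =ᵐ[volume] Metric.ball c r := by
    rw [← Metric.ball_union_sphere, union_ae_eq_left_iff_ae_subset]
    refine ae_le_set.2 (measure_mono_null Set.sdiff_subset ?_)
    exact Measure.addHaar_sphere_of_ne_zero _ _ hr.ne'
  have htr : ∫ x in Metric.ball c r, v x = ∫ z in Metric.ball 0 r, v (c + z) := by
    rw [← (measurePreserving_add_left volume c).setIntegral_preimage_emb
      (measurableEmbedding_addLeft c) v (Metric.ball c r)]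
    simp
  rw [setIntegral_congr_set hae, htr,
    Measure.setIntegral_comp_smul_of_pos volume (fun z => v (c + z)) _ hr,
    smul_unitBall hr.ne', Real.norm_of_nonneg hr.le, finrank_euclideanSpace_fin, smul_eq_mul,
    mul_inv_cancel_left₀ (pow_ne_zero _ hr.ne')]

/-- The continuous cutoffs `max 0 (min 1 (k (1 - ‖y‖²)))` approximate the indicator of the unit
ball. -/
theorem tendsto_integral_cutoff_mul {m : ℕ} {g : EuclideanSpace ℝ (Fin m) → ℝ}
    (hg : Continuous g) :
    Tendsto (fun k : ℕ => ∫ y, max 0 (min 1 ((k : ℝ) * (1 - ‖y‖ ^ 2))) * g y) atTop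
      (nhds (∫ y in Metric.ball 0 1, g y)) := by
  rw [← integral_indicator measurableSet_ball]
  refine tendsto_integral_of_dominated_convergence
    ((Metric.closedBall 0 1).indicator fun y => ‖g y‖) (fun k => ?_) ?_ (fun k => .of_forall ?_)
    (.of_forall ?_)
  · exact Continuous.aestronglyMeasurable (by fun_prop)
  · exact (hg.norm.continuousOn.integrableOn_compact
      (isCompact_closedBall 0 1)).integrable_indicator measurableSet_closedBall
  · intro y
    have hk : (0 : ℝ) ≤ k := k.cast_nonneg
    rcases le_or_gt ‖y‖ 1 with hy | hy
    · rw [Set.indicator_of_mem (by simpa using hy), norm_mul, Real.norm_of_nonneg (le_max_left _ _)]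
      exact mul_le_of_le_one_left (norm_nonneg _) (max_le zero_le_one (min_le_left _ _))
    · rw [Set.indicator_of_notMem (by simpa using hy), max_eq_left
        ((min_le_right _ _).trans (mul_nonpos_of_nonneg_of_nonpos hk (by nlinarith)))]
      simp
  · intro y
    refine tendsto_const_nhds.congr' ?_
    rcases lt_or_ge ‖y‖ 1 with hy | hy
    · have hpos : 0 < 1 - ‖y‖ ^ 2 := by nlinarith [norm_nonneg y]
      filter_upwards [(tendsto_natCast_atTop_atTop.atTop_mul_const hpos).eventually_ge_atTop
        (1 : ℝ)] with k hk
      rw [Set.indicator_of_mem (by simpa using hy), min_eq_left hk, max_eq_right zero_le_one,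
        one_mul]
    · filter_upwards with k
      rw [Set.indicator_of_notMem (by simpa using hy), max_eq_left
        ((min_le_right _ _).trans (mul_nonpos_of_nonneg_of_nonpos k.cast_nonneg (by nlinarith))),
        zero_mul]

/-- Sub-mean value inequality on balls for globally defined `C²` functions with nonnegative
Laplacian on the ball. -/
theorem le_average_closedBall_of_contDiff {m : ℕ} {v : EuclideanSpace ℝ (Fin m) → ℝ}
    (hv : ContDiff ℝ 2 v) {c : EuclideanSpace ℝ (Fin m)} {r : ℝ} (hr : 0 < r)
    (hlap : ∀ x ∈ Metric.closedBall c r, 0 ≤ traceHessian v x) :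
    v c ≤ ⨍ x in Metric.closedBall c r, v x := by
  have hv0 := hv.continuous
  have hle : ∫ _y in Metric.ball (0 : EuclideanSpace ℝ (Fin m)) 1, v c ≤
      ∫ y in Metric.ball 0 1, v (c + r • y) := by
    refine le_of_tendsto_of_tendsto' (tendsto_integral_cutoff_mul continuous_const)
      (tendsto_integral_cutoff_mul (g := fun y => v (c + r • y)) (by fun_prop)) fun k => ?_
    refine integral_cutoff_mul_le (K := fun s => max 0 (min 1 ((k : ℝ) * (1 - s)))) hv hr hlap
      (by fun_prop) (fun s => le_max_left _ _) fun s hs => max_eq_left ((min_le_right _ _).trans ?_)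
    exact mul_nonpos_of_nonneg_of_nonpos k.cast_nonneg (by linarith)
  have hvol : 0 < volume.real (Metric.closedBall c r) :=
    ENNReal.toReal_pos (Metric.measure_closedBall_pos _ _ hr).ne' measure_closedBall_lt_top.ne
  rw [setAverage_eq, smul_eq_mul, le_inv_mul_iff₀ hvol, ← smul_eq_mul, ← setIntegral_const,
    setIntegral_closedBall_eq_setIntegral_unit_ball _ _ hr,
    setIntegral_closedBall_eq_setIntegral_unit_ball _ _ hr]
  exact mul_le_mul_of_nonneg_left hle (pow_nonneg hr.le _)

/-- Sub-mean value inequality on balls for `C²` functions with nonnegative Laplacian on an open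
set. -/
theorem le_average_closedBall_of_contDiffOn {m : ℕ} {v : EuclideanSpace ℝ (Fin m) → ℝ}
    {U : Set (EuclideanSpace ℝ (Fin m))} (hU : IsOpen U) (hv : ContDiffOn ℝ 2 v U)
    (hlap : ∀ x ∈ U, 0 ≤ traceHessian v x) {c : EuclideanSpace ℝ (Fin m)} {r : ℝ} (hr : 0 < r)
    (hcr : Metric.closedBall c r ⊆ U) :
    v c ≤ ⨍ x in Metric.closedBall c r, v x := by
  obtain ⟨η, hη, hηU⟩ := (isCompact_closedBall c r).exists_cthickening_subset_open hU hcr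
  rw [cthickening_closedBall hη.le hr.le] at hηU
  let χ : ContDiffBump c := ⟨r + η / 2, η + r, by linarith, by linarith⟩
  have hχ1 : ∀ x ∈ Metric.closedBall c r, (fun x => χ x * v x) =ᶠ[nhds x] v := by
    intro x hx
    have : Metric.ball c (r + η / 2) ∈ nhds x :=
      Metric.isOpen_ball.mem_nhds (Metric.closedBall_subset_ball (by linarith) hx)
    filter_upwards [this] with y hy
    rw [χ.one_of_mem_closedBall (Metric.ball_subset_closedBall hy), one_mul]
  have hw : ContDiff ℝ 2 fun x => χ x * v x := by
    refine contDiff_iff_contDiffAt.2 fun x => ?_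
    by_cases hx : x ∈ U
    · exact χ.contDiff.contDiffAt.mul (hv.contDiffAt (hU.mem_nhds hx))
    · have hx' : x ∉ tsupport χ := fun h => hx (hηU (by rwa [χ.tsupport_eq] at h))
      refine (contDiffAt_const (c := (0 : ℝ))).congr_of_eventuallyEq ?_
      filter_upwards [notMem_tsupport_iff_eventuallyEq.1 hx'] with y hy
      simp [hy]
  have h := le_average_closedBall_of_contDiff hw hr fun x hx => by
    have := hlap x (hcr hx)
    rwa [traceHessian, (hχ1 x hx).fderiv.fderiv_eq]
  have hc := (hχ1 c (Metric.mem_closedBall_self hr.le)).eq_of_nhds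
  rw [setAverage_eq, setIntegral_congr_fun measurableSet_closedBall
    fun x hx => (hχ1 x hx).eq_of_nhds, ← setAverage_eq] at h
  simpa only [hc] using h

/-- For a symmetric trace-free matrix `A` of size `n + 1`, one has
`|A a|² ≤ n / (n + 1) * |A|² * |a|²`, where `|A|` is the Hilbert–Schmidt norm. -/
theorem sum_sq_mulVec_le_of_symm_of_trace_eq_zero {n : ℕ} (hn : 0 < n)
    {A : Fin (n + 1) → Fin (n + 1) → ℝ} (hsymm : ∀ i j, A i j = A j i) (htr : ∑ i, A i i = 0)
    (a : Fin (n + 1) → ℝ) :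
    ((n : ℝ) + 1) * ∑ i, (∑ j, A i j * a j) ^ 2 ≤ n * ((∑ i, ∑ j, A i j ^ 2) * ∑ j, a j ^ 2) := by
  have hn1 : (1 : ℝ) ≤ n := by exact_mod_cast hn
  obtain ⟨b, hb⟩ : ∃ b : Fin (n + 1) → ℝ, ∀ i, ∑ j, A i j * a j = b i := ⟨_, fun _ => rfl⟩
  obtain ⟨B, hB⟩ : ∃ B, ∑ i, b i ^ 2 = B := ⟨_, rfl⟩
  obtain ⟨N, hN⟩ : ∃ N, ∑ i, ∑ j, A i j ^ 2 = N := ⟨_, rfl⟩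
  obtain ⟨M, hM⟩ : ∃ M, ∑ j, a j ^ 2 = M := ⟨_, rfl⟩
  obtain ⟨t, ht⟩ : ∃ t, ∑ j, a j * b j = t := ⟨_, rfl⟩
  have hB0 : 0 ≤ B := hB ▸ Finset.sum_nonneg fun _ _ => sq_nonneg _
  have hN0 : 0 ≤ N := hN ▸ Finset.sum_nonneg fun _ _ => Finset.sum_nonneg fun _ _ => sq_nonneg _
  have hM0 : 0 ≤ M := hM ▸ Finset.sum_nonneg fun _ _ => sq_nonneg _
  have htBM : t ^ 2 ≤ M * B := by
    rw [← ht, ← hM, ← hB]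
    exact Finset.sum_mul_sq_le_sq_mul_sq _ _ _
  let S : Fin (n + 1) → Fin (n + 1) → ℝ := fun i j =>
    ((n : ℝ) + 1) * (b i * a j + a i * b j) - if i = j then 2 * t else 0
  have hAb : ∑ i, ∑ j, A i j * (b i * a j) = B := by
    rw [← hB]
    refine Finset.sum_congr rfl fun i _ => ?_
    rw [sq, ← hb i, Finset.mul_sum, hb i]
    exact Finset.sum_congr rfl fun j _ => by ring
  have hAS : ∑ i, ∑ j, A i j * S i j = 2 * (n + 1) * B := by
    have hAb' : ∑ i, ∑ j, A i j * (a i * b j) = B := by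
      rw [← hAb, Finset.sum_comm]
      exact Finset.sum_congr rfl fun i _ => Finset.sum_congr rfl fun j _ => by rw [hsymm j i]; ring
    have hAd : ∑ i, ∑ j, A i j * (if i = j then 2 * t else 0) = 0 := by
      simp [← Finset.sum_mul, htr]
    calc ∑ i, ∑ j, A i j * S i j
        = ∑ i, ∑ j, (((n : ℝ) + 1) * (A i j * (b i * a j)) + (n + 1) * (A i j * (a i * b j))
            - A i j * (if i = j then 2 * t else 0)) :=
          Finset.sum_congr rfl fun i _ => Finset.sum_congr rfl fun j _ => by simp only [S]; ring
      _ = 2 * (n + 1) * B := by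
          simp only [Finset.sum_add_distrib, Finset.sum_sub_distrib, ← Finset.mul_sum, hAb, hAb',
            hAd]
          ring
  have hSS : ∑ i, ∑ j, S i j ^ 2 = 2 * (n + 1) ^ 2 * (B * M + t ^ 2) - 4 * (n + 1) * t ^ 2 := by
    have hcross : ∑ i, ∑ j, (b i * a j + a i * b j) * (if i = j then 2 * t else 0) = 4 * t ^ 2 := by
      simp only [mul_ite, mul_zero, Finset.sum_ite_eq, Finset.mem_univ, if_true]
      calc ∑ i, (b i * a i + a i * b i) * (2 * t) = ∑ i, (a i * b i) * (4 * t) :=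
            Finset.sum_congr rfl fun i _ => by ring
        _ = 4 * t ^ 2 := by rw [← Finset.sum_mul, ht]; ring
    have hdiag : ∑ i : Fin (n + 1), ∑ j : Fin (n + 1), (if i = j then 2 * t else 0) ^ 2 =
        4 * (n + 1) * t ^ 2 := by
      simp only [ite_pow, ne_eq, OfNat.ofNat_ne_zero, not_false_eq_true, zero_pow,
        Finset.sum_ite_eq, Finset.mem_univ, if_true, Finset.sum_const, Finset.card_univ,
        Fintype.card_fin, nsmul_eq_mul]
      push_cast
      ring
    calc ∑ i, ∑ j, S i j ^ 2
        = ∑ i, ∑ j, (((n : ℝ) + 1) ^ 2 * (b i ^ 2 * a j ^ 2) + (n + 1) ^ 2 * (a i ^ 2 * b j ^ 2)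
            + 2 * (n + 1) ^ 2 * ((a i * b i) * (a j * b j))
            - 2 * (n + 1) * ((b i * a j + a i * b j) * (if i = j then 2 * t else 0))
            + (if i = j then 2 * t else 0) ^ 2) :=
          Finset.sum_congr rfl fun i _ => Finset.sum_congr rfl fun j _ => by simp only [S]; ring
      _ = _ := by
          simp only [Finset.sum_add_distrib, Finset.sum_sub_distrib, ← Finset.mul_sum,
            ← Finset.sum_mul, hB, hM, ht, hcross, hdiag]
          ring
  have hCS : (∑ i, ∑ j, A i j * S i j) ^ 2 ≤ (∑ i, ∑ j, A i j ^ 2) * ∑ i, ∑ j, S i j ^ 2 := by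
    simp only [← Fintype.sum_prod_type']
    exact Finset.sum_mul_sq_le_sq_mul_sq _ _ _
  rw [hAS, hSS, hN] at hCS
  simp only [hb, hB, hN, hM]
  have h6 : ((n : ℝ) + 1) * (2 * (n + 1) * B ^ 2) ≤
      (n + 1) * (N * ((n + 1) * (B * M) + (n - 1) * t ^ 2)) := by nlinarith
  have h7 := le_of_mul_le_mul_left h6 (by linarith)
  have h8 : N * ((n + 1) * (B * M) + (n - 1) * t ^ 2) ≤ N * (2 * n * (B * M)) := by
    refine mul_le_mul_of_nonneg_left ?_ hN0
    nlinarith [mul_le_mul_of_nonneg_left htBM (sub_nonneg.2 hn1)]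
  rcases hB0.eq_or_lt with h | h
  · rw [← h, mul_zero]
    positivity
  · refine le_of_mul_le_mul_left ?_ h
    nlinarith

/-- Second derivative of a real power of a positive function. -/
theorem fderiv_fderiv_rpow_apply {m : ℕ} {g : EuclideanSpace ℝ (Fin m) → ℝ}
    {x : EuclideanSpace ℝ (Fin m)} (hg : ContDiffAt ℝ 2 g x) (hx : 0 < g x) (p : ℝ)
    (e : EuclideanSpace ℝ (Fin m)) :
    fderiv ℝ (fderiv ℝ fun y => g y ^ p) x e e =
      p * (p - 1) * g x ^ (p - 2) * fderiv ℝ g x e ^ 2 +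
        p * g x ^ (p - 1) * fderiv ℝ (fderiv ℝ g) x e e := by
  have hev : (fderiv ℝ fun y => g y ^ p) =ᶠ[nhds x]
      fun y => (p * g y ^ (p - 1)) • fderiv ℝ g y := by
    filter_upwards [hg.eventually (by simp), hg.continuousAt.eventually_const_lt hx] with y hy hy0
    exact ((hy.differentiableAt two_ne_zero).hasFDerivAt.rpow_const (Or.inl hy0.ne')).fderiv
  have h1 := ((hg.differentiableAt two_ne_zero).hasFDerivAt.rpow_const (p := p - 1)
    (Or.inl hx.ne')).const_mul p
  have h2 := ((hg.fderiv_right (m := 1) (by norm_num)).differentiableAt one_ne_zero).hasFDerivAt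
  rw [hev.fderiv_eq, (h1.fun_smul h2).fderiv]
  simp only [add_apply, smul_apply,
    ContinuousLinearMap.smulRight_apply, smul_eq_mul]
  rw [show p - 1 - 1 = p - 2 by ring]
  ring

/-- First derivative of a sum of squares. -/
theorem hasFDerivAt_sum_sq_add_const {m k : ℕ} {u : Fin k → EuclideanSpace ℝ (Fin m) → ℝ}
    {x : EuclideanSpace ℝ (Fin m)} (hu : ∀ j, DifferentiableAt ℝ (u j) x) (δ : ℝ) :
    HasFDerivAt (fun y => ∑ j, u j y ^ 2 + δ) (∑ j, (2 * u j x) • fderiv ℝ (u j) x) x := by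
  refine (HasFDerivAt.fun_sum fun j _ => ?_).add_const δ
  simpa using (hu j).hasFDerivAt.pow 2

/-- Second derivative of a sum of squares. -/
theorem fderiv_fderiv_sum_sq_add_const_apply {m k : ℕ}
    {u : Fin k → EuclideanSpace ℝ (Fin m) → ℝ} {x : EuclideanSpace ℝ (Fin m)}
    (hu : ∀ j, ContDiffAt ℝ 2 (u j) x) (δ : ℝ) (e : EuclideanSpace ℝ (Fin m)) :
    fderiv ℝ (fderiv ℝ fun y => ∑ j, u j y ^ 2 + δ) x e e =
      2 * ∑ j, fderiv ℝ (u j) x e ^ 2 + 2 * ∑ j, u j x * fderiv ℝ (fderiv ℝ (u j)) x e e := by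
  have hev : (fderiv ℝ fun y => ∑ j, u j y ^ 2 + δ) =ᶠ[nhds x]
      fun y => ∑ j, (2 * u j y) • fderiv ℝ (u j) y := by
    filter_upwards [eventually_all.2 fun j => (hu j).eventually (by simp)] with y hy
    exact (hasFDerivAt_sum_sq_add_const (fun j => (hy j).differentiableAt two_ne_zero) δ).fderiv
  have h1 : ∀ j, HasFDerivAt (fun y => (2 * u j y) • fderiv ℝ (u j) y) _ x := fun j =>
    (((hu j).differentiableAt two_ne_zero).hasFDerivAt.const_mul 2).fun_smul
      (((hu j).fderiv_right (m := 1) (by norm_num)).differentiableAt one_ne_zero).hasFDerivAt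
  rw [hev.fderiv_eq, (HasFDerivAt.fun_sum fun j _ => h1 j).fderiv, Finset.mul_sum, Finset.mul_sum,
    ← Finset.sum_add_distrib]
  simp only [sum_apply, add_apply,
    smul_apply, ContinuousLinearMap.smulRight_apply, smul_eq_mul]
  exact Finset.sum_congr rfl fun j _ => by ring

/-- Components of a `C²` solution of the generalized Cauchy–Riemann equations are harmonic. -/
theorem traceHessian_eq_zero_of_cauchyRiemann {m : ℕ}
    {u : Fin m → EuclideanSpace ℝ (Fin m) → ℝ} {U : Set (EuclideanSpace ℝ (Fin m))}
    (hU : IsOpen U) (hreg : ∀ i, ContDiffOn ℝ 2 (u i) U)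
    (hdiv : ∀ x ∈ U, ∑ j, fderiv ℝ (u j) x (EuclideanSpace.single j 1) = 0)
    (hcurl : ∀ i j, ∀ x ∈ U, fderiv ℝ (u i) x (EuclideanSpace.single j 1) =
      fderiv ℝ (u j) x (EuclideanSpace.single i 1))
    {x : EuclideanSpace ℝ (Fin m)} (hx : x ∈ U) (j : Fin m) : traceHessian (u j) x = 0 := by
  have hUx := hU.mem_nhds hx
  have hu : ∀ i, ContDiffAt ℝ 2 (u i) x := fun i => (hreg i).contDiffAt hUx
  have hd : ∀ i, DifferentiableAt ℝ (fderiv ℝ (u i)) x := fun i =>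
    ((hu i).fderiv_right (m := 1) (by norm_num)).differentiableAt one_ne_zero
  have hap : ∀ i (e w : EuclideanSpace ℝ (Fin m)),
      fderiv ℝ (fderiv ℝ (u i)) x w e = fderiv ℝ (fun y => fderiv ℝ (u i) y e) x w := by
    intro i e w
    rw [fderiv_clm_apply (hd i) (by fun_prop)]
    simp
  have hz : fderiv ℝ (fun y => ∑ i, fderiv ℝ (u i) y (EuclideanSpace.single i 1)) x = 0 := by
    have : (fun y => ∑ i, fderiv ℝ (u i) y (EuclideanSpace.single i 1)) =ᶠ[nhds x]
        fun _ => (0 : ℝ) := by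
      filter_upwards [hUx] with y hy using hdiv y hy
    rw [this.fderiv_eq, fderiv_fun_const]
    rfl
  have hdi : ∀ i ∈ Finset.univ,
      DifferentiableAt ℝ (fun y => fderiv ℝ (u i) y (EuclideanSpace.single i 1)) x :=
    fun i _ => (hd i).clm_apply (differentiableAt_const _)
  rw [fderiv_fun_sum hdi] at hz
  have hz' := congrArg (fun L => L (EuclideanSpace.single j (1 : ℝ))) hz
  simp only [sum_apply, zero_apply] at hz'
  rw [traceHessian, ← hz']
  refine Finset.sum_congr rfl fun i _ => ?_
  have hc : (fun y => fderiv ℝ (u j) y (EuclideanSpace.single i 1)) =ᶠ[nhds x]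
      fun y => fderiv ℝ (u i) y (EuclideanSpace.single j 1) := by
    filter_upwards [hUx] with y hy using hcurl j i y hy
  rw [hap, hc.fderiv_eq, ← hap, ← hap]
  exact (hu i).isSymmSndFDerivAt (by simp) _ _

/-- The regularized power `(|F|² + δ)^p` of a system of conjugate harmonic functions has
nonnegative Laplacian as soon as `2 p ≥ (n - 1) / n`. -/
theorem traceHessian_rpow_sum_sq_nonneg {n : ℕ} (hn : 0 < n)
    {u : Fin (n + 1) → EuclideanSpace ℝ (Fin (n + 1)) → ℝ}
    {x : EuclideanSpace ℝ (Fin (n + 1))} (hu : ∀ i, ContDiffAt ℝ 2 (u i) x)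
    (hharm : ∀ i, traceHessian (u i) x = 0)
    (hdiv : ∑ j, fderiv ℝ (u j) x (EuclideanSpace.single j 1) = 0)
    (hcurl : ∀ i j, fderiv ℝ (u i) x (EuclideanSpace.single j 1) =
      fderiv ℝ (u j) x (EuclideanSpace.single i 1))
    {p : ℝ} (hp0 : 0 ≤ p) (hp : (n : ℝ) - 1 ≤ 2 * p * n) {δ : ℝ} (hδ : 0 < δ) :
    0 ≤ traceHessian (fun y => (∑ j, u j y ^ 2 + δ) ^ p) x := by
  let g : EuclideanSpace ℝ (Fin (n + 1)) → ℝ := fun y => ∑ j, u j y ^ 2 + δ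
  have hM0 : 0 ≤ ∑ j, u j x ^ 2 := Finset.sum_nonneg fun _ _ => sq_nonneg _
  have hg0 : 0 < g x := add_pos_of_nonneg_of_pos hM0 hδ
  have hg : ContDiffAt ℝ 2 g x := (ContDiffAt.sum fun j _ => (hu j).pow 2).add contDiffAt_const
  have hn0 : (0 : ℝ) < n := by exact_mod_cast hn
  have hmat := sum_sq_mulVec_le_of_symm_of_trace_eq_zero hn
    (A := fun i j => fderiv ℝ (u j) x (EuclideanSpace.single i 1)) (fun i j => hcurl j i) hdiv
    (fun j => u j x)
  have hB0 : 0 ≤ ∑ i, (∑ j, fderiv ℝ (u j) x (EuclideanSpace.single i 1) * u j x) ^ 2 :=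
    Finset.sum_nonneg fun _ _ => sq_nonneg _
  have hN0 : 0 ≤ ∑ i, ∑ j, fderiv ℝ (u j) x (EuclideanSpace.single i 1) ^ 2 :=
    Finset.sum_nonneg fun _ _ => Finset.sum_nonneg fun _ _ => sq_nonneg _
  have hQ : ∑ i, fderiv ℝ g x (EuclideanSpace.single i 1) ^ 2 =
      4 * ∑ i, (∑ j, fderiv ℝ (u j) x (EuclideanSpace.single i 1) * u j x) ^ 2 := by
    rw [Finset.mul_sum]
    refine Finset.sum_congr rfl fun i _ => ?_
    rw [(hasFDerivAt_sum_sq_add_const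
      (fun j => (hu j).differentiableAt two_ne_zero) δ).fderiv]
    simp only [sum_apply, smul_apply, smul_eq_mul]
    rw [show (4 : ℝ) = 2 ^ 2 by norm_num, ← mul_pow, Finset.mul_sum]
    exact congrArg (· ^ 2) (Finset.sum_congr rfl fun j _ => by ring)
  have hL : traceHessian g x =
      2 * ∑ i, ∑ j, fderiv ℝ (u j) x (EuclideanSpace.single i 1) ^ 2 := by
    have h0 : ∑ i : Fin (n + 1), ∑ j, u j x * fderiv ℝ (fderiv ℝ (u j)) x
        (EuclideanSpace.single i 1) (EuclideanSpace.single i 1) = 0 := by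
      rw [Finset.sum_comm]
      refine Finset.sum_eq_zero fun j _ => ?_
      rw [← Finset.mul_sum]
      exact mul_eq_zero_of_right _ (hharm j)
    simp only [traceHessian, g, fderiv_fderiv_sum_sq_add_const_apply hu, Finset.sum_add_distrib,
      ← Finset.mul_sum, h0, mul_zero, add_zero]
  have hpow : g x ^ (p - 1) = g x ^ (p - 2) * g x := by
    rw [← Real.rpow_add_one hg0.ne']
    congr 1
    ring
  have hmain : traceHessian (fun y => g y ^ p) x = p * g x ^ (p - 2) *
      ((p - 1) * ∑ i, fderiv ℝ g x (EuclideanSpace.single i 1) ^ 2 + g x * traceHessian g x) := by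
    simp only [traceHessian, fderiv_fderiv_rpow_apply hg hg0, Finset.sum_add_distrib,
      ← Finset.mul_sum, hpow]
    ring
  change 0 ≤ traceHessian (fun y => g y ^ p) x
  rw [hmain, hQ, hL]
  refine mul_nonneg (mul_nonneg hp0 (Real.rpow_nonneg hg0.le _)) ?_
  have hgM : ∑ j, u j x ^ 2 ≤ g x := le_add_of_nonneg_right hδ.le
  generalize ∑ i, (∑ j, fderiv ℝ (u j) x (EuclideanSpace.single i 1) * u j x) ^ 2 = B at *
  generalize ∑ i, ∑ j, fderiv ℝ (u j) x (EuclideanSpace.single i 1) ^ 2 = N at *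
  generalize ∑ j, u j x ^ 2 = M at *
  have h1 : (n : ℝ) * (N * M) ≤ n * (N * g x) := by gcongr
  have h2 : 0 ≤ (n : ℝ) * ((p - 1) * (4 * B) + g x * (2 * N)) := by
    nlinarith [mul_le_mul_of_nonneg_right hp hB0]
  exact nonneg_of_mul_nonneg_right h2 hn0

theorem isOpen_upperHalf (n : ℕ) : IsOpen (upperHalf n) :=
  isOpen_lt continuous_const (by fun_prop)

theorem stmt_11 (n : ℕ) (hn : 0 < n)
    (u : Fin (n + 1) → EuclideanSpace ℝ (Fin (n + 1)) → ℝ)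
    (hreg : ∀ i, ContDiffOn ℝ 2 (u i) (upperHalf n))
    (hCR1 : ∀ x ∈ upperHalf n,
      ∑ j : Fin (n + 1), fderiv ℝ (u j) x (EuclideanSpace.single j 1) = 0)
    (hCR2 : ∀ (i j : Fin (n + 1)), ∀ x ∈ upperHalf n,
      fderiv ℝ (u i) x (EuclideanSpace.single j 1) =
        fderiv ℝ (u j) x (EuclideanSpace.single i 1))
    (ε : ℝ) (hε : ((n : ℝ) - 1) / n ≤ ε) :
    SubharmonicOn' (fun x => (∑ j : Fin (n + 1), u j x ^ 2) ^ (ε / 2))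
      (upperHalf n) := by
  have hU := isOpen_upperHalf n
  have hn0 : (0 : ℝ) < n := by exact_mod_cast hn
  have hn1 : (1 : ℝ) ≤ n := by exact_mod_cast hn
  have hε0 : 0 ≤ ε := (div_nonneg (sub_nonneg.2 hn1) hn0.le).trans hε
  have hp0 : 0 ≤ ε / 2 := by positivity
  have hp : (n : ℝ) - 1 ≤ 2 * (ε / 2) * n := by
    rw [div_le_iff₀ hn0] at hε
    linarith
  have hs0 : ∀ x, 0 ≤ ∑ j, u j x ^ 2 := fun x => Finset.sum_nonneg fun _ _ => sq_nonneg _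
  have hsc : ContinuousOn (fun x => ∑ j, u j x ^ 2) (upperHalf n) :=
    continuousOn_finsetSum _ fun j _ => (hreg j).continuousOn.pow 2
  have hδc : ∀ δ : ℝ, ContinuousOn (fun x => (∑ j, u j x ^ 2 + δ) ^ (ε / 2)) (upperHalf n) :=
    fun δ => (Real.continuous_rpow_const hp0).comp_continuousOn (hsc.add continuousOn_const)
  refine ⟨(Real.continuous_rpow_const hp0).comp_continuousOn hsc, fun c r hr hcr => ?_⟩
  have hlim : ∀ x, Tendsto (fun δ : ℝ => (∑ j, u j x ^ 2 + δ) ^ (ε / 2))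
      (nhdsWithin 0 (Set.Ioi 0)) (nhds ((∑ j, u j x ^ 2) ^ (ε / 2))) := by
    intro x
    have h : Continuous fun δ : ℝ => (∑ j, u j x ^ 2 + δ) ^ (ε / 2) :=
      (Real.continuous_rpow_const hp0).comp (continuous_const.add continuous_id)
    simpa using (h.tendsto 0).mono_left nhdsWithin_le_nhds
  have h_integral : Tendsto (fun δ : ℝ => ∫ x in Metric.closedBall c r, (∑ j, u j x ^ 2 + δ) ^ (ε / 2))
      (nhdsWithin 0 (Set.Ioi 0))
      (nhds (∫ x in Metric.closedBall c r, (∑ j, u j x ^ 2) ^ (ε / 2))) := by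
    refine tendsto_integral_filter_of_dominated_convergence
      (fun x => (∑ j, u j x ^ 2 + 1) ^ (ε / 2)) (.of_forall fun δ => ?_) ?_ ?_
      (.of_forall hlim)
    · exact ((hδc δ).mono hcr).aestronglyMeasurable measurableSet_closedBall
    · filter_upwards [Ioc_mem_nhdsGT (zero_lt_one' ℝ)] with δ hδ
      refine .of_forall fun x => ?_
      have h0 : 0 ≤ ∑ j, u j x ^ 2 + δ := add_nonneg (hs0 x) hδ.1.le
      rw [Real.norm_of_nonneg (Real.rpow_nonneg h0 _)]
      exact Real.rpow_le_rpow h0 (add_le_add_right hδ.2 _) hp0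
    · exact ((hδc 1).mono hcr).integrableOn_compact (isCompact_closedBall c r)
  rw [setAverage_eq]
  refine le_of_tendsto_of_tendsto (hlim c) (h_integral.const_smul _) ?_
  filter_upwards [self_mem_nhdsWithin] with δ hδ
  rw [← setAverage_eq]
  refine le_average_closedBall_of_contDiffOn (v := fun x => (∑ j, u j x ^ 2 + δ) ^ (ε / 2)) hU
    ?_ (fun x hx => ?_) hr hcr
  · exact ((ContDiffOn.sum fun j _ => (hreg j).pow 2).add contDiffOn_const).rpow_const_of_ne
      fun x _ => (add_pos_of_nonneg_of_pos (hs0 x) hδ).ne'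
  · exact traceHessian_rpow_sum_sq_nonneg hn (fun i => (hreg i).contDiffAt (hU.mem_nhds hx))
      (traceHessian_eq_zero_of_cauchyRiemann hU hreg hCR1 hCR2 hx) (hCR1 x hx)
      (fun i j => hCR2 i j x hx) hp0 hp hδ
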